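/- Let G be a hyperbolic group and H an infinite quasiconvex subgroup of infinite index in G, with limit set L ⊂ ∂G and pattern ℒ = {gL : g ∈ G}. Then any group Q of pattern-preserving quasi-isometries of G is totally disconnected in the uniform topology. -/

import Mathlib

noncomputable section
open scoped NNReal ENNReal

/-- A `(K, ε)`-quasi-isometry between two (pseudo)distance functions: coarsely bi-Lipschitz
with `ε`-dense image. -/
def IsQuasiIsometryDist {α β : Type*} (d₁ : α → α → ℝ) (d₂ : β → β → ℝ) (K ε : ℝ)
    (f : α → β) : Prop :=
  (∀ x y, d₁ x y / K - ε ≤ d₂ (f x) (f y) ∧ d₂ (f x) (f y) ≤ K * d₁ x y + ε) ∧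
    ∀ z, ∃ x, d₂ z (f x) ≤ ε

/-- Two self maps are at bounded distance from each other. -/
def BoundedDistEquiv {α : Type*} (d : α → α → ℝ) (f g : α → α) : Prop :=
  ∃ C : ℝ, ∀ x, d (f x) (g x) ≤ C

/-- The Gromov product of `x` and `y` with respect to the basepoint `b`. -/
def gromovProd {α : Type*} (d : α → α → ℝ) (x y b : α) : ℝ := (d x b + d y b - d x y) / 2

/-- Gromov hyperbolicity (four-point condition) of a distance function. -/
def IsGromovHyperbolicDist {α : Type*} (d : α → α → ℝ) (δ : ℝ) : Prop :=
  ∀ x y z b, min (gromovProd d x z b) (gromovProd d z y b) - δ ≤ gromovProd d x y b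

/-- The Cayley graph of a group with respect to a generating set `S`. -/
def cayleyGraph (G : Type*) [Group G] (S : Set G) : SimpleGraph G :=
  SimpleGraph.fromRel (fun g h => g⁻¹ * h ∈ S)

/-- The word metric on a group `G` with respect to a generating set `S`, as a real valued
distance function (the graph metric of the Cayley graph). -/
noncomputable def wordDist (G : Type*) [Group G] (S : Set G) (g h : G) : ℝ :=
  ((cayleyGraph G S).dist g h : ℝ)
/-- A sequence converging at infinity in a hyperbolic space: the Gromov products
`(u m | u n)` tend to infinity. -/
def ConvergesAtInfinity {α : Type*} (d : α → α → ℝ) (b : α) (u : ℕ → α) : Prop :=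
  Filter.Tendsto (fun p : ℕ × ℕ => gromovProd d (u p.1) (u p.2) b) Filter.atTop Filter.atTop

/-- A sequence together with the fact that it converges at infinity. -/
structure BoundarySeq {α : Type*} (d : α → α → ℝ) (b : α) where
  seq : ℕ → α
  conv : ConvergesAtInfinity d b seq

/-- Two sequences converging at infinity represent the same boundary point. -/
def boundaryRel {α : Type*} (d : α → α → ℝ) (b : α) (u v : BoundarySeq d b) : Prop :=
  Filter.Tendsto (fun p : ℕ × ℕ => gromovProd d (u.seq p.1) (v.seq p.2) b)
    Filter.atTop Filter.atTop

/-- The Gromov boundary: sequences converging at infinity modulo mutual convergence. -/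
def GromovBoundary {α : Type*} (d : α → α → ℝ) (b : α) := Quot (boundaryRel d b)

/-- The Gromov product of two boundary sequences. -/
noncomputable def bSeqProd {α : Type*} (d : α → α → ℝ) (b : α) (u v : BoundarySeq d b) : ℝ :=
  Filter.liminf (fun p : ℕ × ℕ => gromovProd d (u.seq p.1) (v.seq p.2) b) Filter.atTop

/-- The bijection `e` identifies the metric space `Z` with the Gromov boundary, and the metric
of `Z` is a visual metric with parameters `a` and `C`. -/
def IsVisualMetric {α Z : Type*} [MetricSpace Z] (d : α → α → ℝ) (b : α)
    (e : GromovBoundary d b ≃ Z) (a C : ℝ) : Prop :=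
  1 < a ∧ 1 ≤ C ∧ ∀ u v : BoundarySeq d b, ¬ boundaryRel d b u v →
    C⁻¹ * a ^ (-(bSeqProd d b u v)) ≤ dist (e (Quot.mk _ u)) (e (Quot.mk _ v)) ∧
      dist (e (Quot.mk _ u)) (e (Quot.mk _ v)) ≤ C * a ^ (-(bSeqProd d b u v))

/-- `h : Z₁ → Z₂` is the boundary extension of the map `φ : α → β`, where `Z₁, Z₂` are
identified with the Gromov boundaries via `e₁, e₂`. -/
def BoundaryMapExtends {α β Z₁ Z₂ : Type*} (d₁ : α → α → ℝ) (b₁ : α) (d₂ : β → β → ℝ) (b₂ : β)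
    (e₁ : GromovBoundary d₁ b₁ ≃ Z₁) (e₂ : GromovBoundary d₂ b₂ ≃ Z₂)
    (h : Z₁ → Z₂) (φ : α → β) : Prop :=
  ∀ u : BoundarySeq d₁ b₁, ∃ v : BoundarySeq d₂ b₂,
    (∀ n, v.seq n = φ (u.seq n)) ∧ h (e₁ (Quot.mk _ u)) = e₂ (Quot.mk _ v)

/-- The limit set of a subset `A`, inside the Gromov boundary. -/
def limitSet {α : Type*} (d : α → α → ℝ) (b : α) (A : Set α) : Set (GromovBoundary d b) :=
  {ξ | ∃ u : BoundarySeq d b, (∀ n, u.seq n ∈ A) ∧ ξ = Quot.mk _ u}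

/-- A discrete geodesic segment of length `n`. -/
def IsGeodesicSegment {α : Type*} (d : α → α → ℝ) (n : ℕ) (γ : ℕ → α) : Prop :=
  ∀ i j : ℕ, i ≤ n → j ≤ n → d (γ i) (γ j) = |(i : ℝ) - (j : ℝ)|

/-- Quasiconvexity of a subset with constant `D`: every discrete geodesic with endpoints in the
subset stays within distance `D` of it. -/
def IsQuasiconvexWith {α : Type*} (d : α → α → ℝ) (D : ℝ) (A : Set α) : Prop :=
  ∀ (n : ℕ) (γ : ℕ → α), IsGeodesicSegment d n γ → γ 0 ∈ A → γ n ∈ A →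
    ∀ i ≤ n, ∃ a ∈ A, d (γ i) a ≤ D

/-- Quasiconvexity of a subset. -/
def IsQuasiconvex {α : Type*} (d : α → α → ℝ) (A : Set α) : Prop :=
  ∃ D : ℝ, 0 ≤ D ∧ IsQuasiconvexWith d D A
/-- The self-homeomorphism group of a topological space. -/
instance homeoGroup (Z : Type*) [TopologicalSpace Z] : Group (Z ≃ₜ Z) where
  mul f g := g.trans f
  one := Homeomorph.refl Z
  inv := Homeomorph.symm
  mul_assoc f g h := Homeomorph.ext fun _ => rfl
  one_mul f := Homeomorph.ext fun _ => rfl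
  mul_one f := Homeomorph.ext fun _ => rfl
  inv_mul_cancel f := Homeomorph.ext fun x => f.symm_apply_apply x

/-- The topology of uniform convergence on the self-homeomorphism group of a metric space. -/
instance homeoUniformTopology (Z : Type*) [MetricSpace Z] : TopologicalSpace (Z ≃ₜ Z) :=
  TopologicalSpace.induced (fun f => UniformFun.ofFun (f : Z → Z)) inferInstance
/-- The pattern associated to a subgroup `H`: the collection of the translates of the limit set
of `H`, transported to `Z` by the identification `e`. -/
def patternOf {G : Type*} [Group G] (d : G → G → ℝ) (b : G) {Z : Type*}
    (e : GromovBoundary d b ≃ Z) (H : Subgroup G) : Set (Set Z) :=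
  Set.range (fun g : G => e '' limitSet d b ((g * ·) '' (H : Set G)))

/-- A self-map of `Z` preserves the pattern of `H`. -/
def PatternPreserving {G : Type*} [Group G] (d : G → G → ℝ) (b : G) {Z : Type*}
    (e : GromovBoundary d b ≃ Z) (H : Subgroup G) (q : Z → Z) : Prop :=
  ∀ P ∈ patternOf d b e H, q '' P ∈ patternOf d b e H

open Filter Topology

/-- Working properties of the word metric. -/
structure GoodDist {G : Type*} [Group G] (d : G → G → ℝ) : Prop where
  self : ∀ x, d x x = 0
  symm : ∀ x y, d x y = d y x
  tri : ∀ x y z, d x z ≤ d x y + d y z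
  inv : ∀ g x y, d (g * x) (g * y) = d x y
  fin : ∀ r : ℝ, {x | d 1 x ≤ r}.Finite
  geo : ∀ x y, ∃ (n : ℕ) (γ : ℕ → G), IsGeodesicSegment d n γ ∧ γ 0 = x ∧ γ n = y

theorem GoodDist.nonneg {G : Type*} [Group G] {d : G → G → ℝ} (hd : GoodDist d) (x y : G) :
    0 ≤ d x y := by
  have h1 := hd.tri x y x
  have h2 := hd.self x
  have h3 := hd.symm x y
  linarith

theorem cayley_connected {G : Type*} [Group G] (S : Set G) (hSgen : Subgroup.closure S = ⊤) :
    (cayleyGraph G S).Connected := by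
  have key : ∀ g : G, ∀ x : G, (cayleyGraph G S).Reachable x (x * g) := by
    intro g
    have hg : g ∈ Subgroup.closure S := by rw [hSgen]; trivial
    induction hg using Subgroup.closure_induction with
    | mem s hs =>
      intro x
      by_cases h : x = x * s
      · rw [← h]
      · apply SimpleGraph.Adj.reachable
        rw [cayleyGraph, SimpleGraph.fromRel_adj]
        exact ⟨h, Or.inl (by simpa using hs)⟩
    | one => intro x; simp
    | mul a b _ _ ha hb =>
      intro x
      have := (ha x).trans (hb (x * a))
      rwa [mul_assoc] at this
    | inv a _ ha =>
      intro x
      have := ha (x * a⁻¹)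
      simpa using this.symm
  have : Nonempty G := ⟨1⟩
  refine SimpleGraph.Connected.mk ?_
  intro x y
  simpa using key (x⁻¹ * y) x

theorem cayley_adj_mul {G : Type*} [Group G] (S : Set G) (g x y : G)
    (h : (cayleyGraph G S).Adj x y) : (cayleyGraph G S).Adj (g * x) (g * y) := by
  rw [cayleyGraph, SimpleGraph.fromRel_adj] at h ⊢
  refine ⟨by simpa using h.1, ?_⟩
  simpa [mul_assoc] using h.2

theorem wordDist_good {G : Type*} [Group G] (S : Set G) (hSfin : S.Finite)
    (hSgen : Subgroup.closure S = ⊤) : GoodDist (wordDist G S) := by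
  have hc := cayley_connected S hSgen
  have hself : ∀ x, wordDist G S x x = 0 := fun x => by simp [wordDist]
  have hsymm : ∀ x y, wordDist G S x y = wordDist G S y x := fun x y => by
    simp only [wordDist]; rw [SimpleGraph.dist_comm]
  have htri : ∀ x y z, wordDist G S x z ≤ wordDist G S x y + wordDist G S y z := fun x y z => by
    simp only [wordDist]; exact_mod_cast hc.dist_triangle
  refine ⟨hself, hsymm, htri, ?_, ?_, ?_⟩
  · have hle : ∀ g x y, (cayleyGraph G S).dist (g * x) (g * y) ≤ (cayleyGraph G S).dist x y := by
      intro g x y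
      obtain ⟨p, hp⟩ := hc.exists_walk_length_eq_dist x y
      let f : cayleyGraph G S →g cayleyGraph G S := ⟨fun x => g * x, fun h => cayley_adj_mul S g _ _ h⟩
      have := SimpleGraph.dist_le (p.map f)
      rw [SimpleGraph.Walk.length_map, hp] at this
      exact this
    intro g x y
    simp only [wordDist]
    have h1 := hle g x y
    have h2 := hle g⁻¹ (g * x) (g * y)
    simp only [inv_mul_cancel_left] at h2
    exact_mod_cast le_antisymm h1 h2
  · have key : ∀ n : ℕ, {x : G | ∃ p : (cayleyGraph G S).Walk x 1, p.length = n}.Finite := by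
      intro n
      induction n with
      | zero =>
        refine (Set.finite_singleton (1 : G)).subset ?_
        rintro x ⟨p, hp⟩
        exact SimpleGraph.Walk.eq_of_length_eq_zero hp
      | succ n ih =>
        refine ((Set.Finite.image2 (fun y s => y * s) ih (hSfin.union hSfin.inv))).subset ?_
        rintro x ⟨p, hp⟩
        cases p with
        | nil => simp at hp
        | cons h q =>
          rename_i y
          refine ⟨y, ⟨q, by simpa using hp⟩, y⁻¹ * x, ?_, by simp⟩
          rw [cayleyGraph, SimpleGraph.fromRel_adj] at h
          rcases h.2 with h | h
          · right; simpa using h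
          · left; exact h
    intro r
    refine ((Set.finite_le_nat ⌊r⌋₊).biUnion (fun n _ => key n)).subset ?_
    intro x hx
    obtain ⟨p, hp⟩ := hc.exists_walk_length_eq_dist x 1
    simp only [Set.mem_iUnion]
    refine ⟨p.length, ?_, p, rfl⟩
    have hx' : wordDist G S x 1 ≤ r := by rw [hsymm]; exact hx
    simp only [wordDist] at hx'
    rw [hp]
    exact Nat.le_floor hx'
  · intro x y
    obtain ⟨p, hp⟩ := hc.exists_walk_length_eq_dist x y
    have step : ∀ i, wordDist G S (p.getVert i) (p.getVert (i + 1)) ≤ 1 := by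
      intro i
      by_cases hi : i < p.length
      · have := p.adj_getVert_succ hi
        simp only [wordDist]
        exact_mod_cast (SimpleGraph.dist_eq_one_iff_adj.2 this).le
      · rw [p.getVert_of_length_le (by omega), p.getVert_of_length_le (by omega), hself]
        norm_num
    have steps : ∀ k i, wordDist G S (p.getVert i) (p.getVert (i + k)) ≤ k := by
      intro k i
      induction k with
      | zero => simp [hself]
      | succ k ih =>
        have h1 := htri (p.getVert i) (p.getVert (i + k)) (p.getVert (i + (k + 1)))
        have h2 := step (i + k)
        rw [add_assoc] at h2
        push_cast
        linarith
    have main : ∀ i j : ℕ, i ≤ j → j ≤ p.length →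
        wordDist G S (p.getVert i) (p.getVert j) = (j : ℝ) - i := by
      intro i j hij hj
      obtain ⟨k, rfl⟩ := Nat.exists_eq_add_of_le hij
      obtain ⟨l, hl⟩ := Nat.exists_eq_add_of_le hj
      have h1 := steps k i
      have h2 := steps i 0
      have h3 := steps l (i + k)
      rw [← hl] at h3
      rw [zero_add] at h2
      have h4 := htri (p.getVert 0) (p.getVert i) (p.getVert p.length)
      have h5 := htri (p.getVert i) (p.getVert (i + k)) (p.getVert p.length)
      have h6 : wordDist G S (p.getVert 0) (p.getVert p.length) = i + k + l := by
        rw [p.getVert_zero, p.getVert_length, wordDist, ← hp, hl]; push_cast; ring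
      push_cast
      linarith
    refine ⟨p.length, p.getVert, ?_, p.getVert_zero, p.getVert_length⟩
    intro i j hi hj
    rcases le_total i j with h | h
    · rw [main i j h hj, abs_sub_comm, abs_of_nonneg]
      have : (i : ℝ) ≤ j := by exact_mod_cast h
      linarith
    · rw [hsymm, main j i h hi, abs_of_nonneg]
      have : (j : ℝ) ≤ i := by exact_mod_cast h
      linarith

section Abstract

variable {G : Type*} [Group G] {d : G → G → ℝ}

/-- A point of the geodesic is close to the base point. -/
theorem geo_close (hd : GoodDist d) {δ : ℝ} (hhyp : IsGromovHyperbolicDist d δ)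
    (b x y : G) (n : ℕ) (γ : ℕ → G) (hγ : IsGeodesicSegment d n γ) (h0 : γ 0 = x) (hn : γ n = y) :
    ∃ i ≤ n, d b (γ i) ≤ gromovProd d x y b + 2 * δ + 1 := by
  have hxy : d x y = n := by
    rw [← h0, ← hn, hγ 0 n (Nat.zero_le _) le_rfl]; simp
  have t1 := hd.tri x b y
  have t2 := hd.tri x y b
  have t3 := hd.tri y x b
  have s1 := hd.symm b y
  have s2 := hd.symm x y
  obtain ⟨t, ht⟩ : ∃ t, t = (d x b + d x y - d y b) / 2 := ⟨_, rfl⟩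
  have ht0 : 0 ≤ t := by rw [ht]; linarith
  have htn : t ≤ n := by rw [ht]; linarith
  have f1 := Nat.floor_le ht0
  have f2 := Nat.lt_floor_add_one t
  have hi : ⌊t⌋₊ ≤ n := by
    have : (⌊t⌋₊ : ℝ) ≤ n := f1.trans htn
    exact_mod_cast this
  refine ⟨⌊t⌋₊, hi, ?_⟩
  have hin : (⌊t⌋₊ : ℝ) ≤ n := f1.trans htn
  have e1 : d x (γ ⌊t⌋₊) = ⌊t⌋₊ := by
    rw [← h0, hγ 0 _ (Nat.zero_le _) hi]; simp
  have e2 : d (γ ⌊t⌋₊) y = n - ⌊t⌋₊ := by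
    rw [← hn, hγ _ n hi le_rfl, abs_sub_comm, abs_of_nonneg (by linarith)]
  have h := hhyp x y (γ ⌊t⌋₊) b
  have s3 := hd.symm b (γ ⌊t⌋₊)
  simp only [gromovProd] at h ⊢
  rcases min_choice ((d x b + d (γ ⌊t⌋₊) b - d x (γ ⌊t⌋₊)) / 2)
    ((d (γ ⌊t⌋₊) b + d y b - d (γ ⌊t⌋₊) y) / 2) with hm | hm <;> rw [hm] at h <;> linarith

theorem coset_close (hd : GoodDist d) {δ D : ℝ} (hhyp : IsGromovHyperbolicDist d δ)
    (H : Subgroup G) (hD : IsQuasiconvexWith d D (H : Set G)) (g h₁ h₂ : G)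
    (hh₁ : h₁ ∈ H) (hh₂ : h₂ ∈ H) :
    ∃ h ∈ H, d 1 (g * h) ≤ gromovProd d (g * h₁) (g * h₂) 1 + 2 * δ + 1 + D := by
  obtain ⟨n, γ, hγ, h0, hn⟩ := hd.geo h₁ h₂
  have hγ' : IsGeodesicSegment d n (fun i => g * γ i) := by
    intro i j hi hj
    rw [hd.inv]; exact hγ i j hi hj
  obtain ⟨i, hi, hle⟩ := geo_close hd hhyp 1 (g * h₁) (g * h₂) n _ hγ' (by simp [h0]) (by simp [hn])
  obtain ⟨h, hh, hd'⟩ := hD n γ hγ (by rw [h0]; exact hh₁) (by rw [hn]; exact hh₂) i hi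
  refine ⟨h, hh, ?_⟩
  have := hd.tri 1 (g * γ i) (g * h)
  rw [hd.inv] at this
  linarith

theorem ultra_const {β : Type*} (f : ℕ → β) (s : Set β) (hs : s.Finite)
    (h : ∀ᶠ n in (hyperfilter ℕ : Filter ℕ), f n ∈ s) :
    ∃ c, ∀ᶠ n in (hyperfilter ℕ : Filter ℕ), f n = c := by
  have h' : ∀ᶠ n in (hyperfilter ℕ : Filter ℕ), ∃ c ∈ s, f n = c := by
    filter_upwards [h] with n hn
    exact ⟨_, hn, rfl⟩
  obtain ⟨c, _, hc⟩ := (Ultrafilter.eventually_exists_mem_iff (P := fun c n => f n = c) hs).1 h'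
  exact ⟨c, hc⟩

theorem ultra_ge (k : ℕ) : ∀ᶠ n in (hyperfilter ℕ : Filter ℕ), k ≤ n := by
  have : (hyperfilter ℕ : Filter ℕ) ≤ atTop := by
    rw [← Nat.cofinite_eq_atTop]; exact hyperfilter_le_cofinite
  exact this (eventually_ge_atTop k)

/-- An infinite quasiconvex subgroup has two distinct limit points. -/
theorem two_limit_points (hd : GoodDist d)
    (H : Subgroup G) (hHinf : (H : Set G).Infinite) {D : ℝ} (hD0 : 0 ≤ D)
    (hD : IsQuasiconvexWith d D (H : Set G)) :
    ∃ u v : ℕ → G, (∀ n, u n ∈ H) ∧ (∀ n, v n ∈ H) ∧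
      ConvergesAtInfinity d 1 u ∧ ConvergesAtInfinity d 1 v ∧
      ∃ R, ∀ m n, gromovProd d (u m) (v n) 1 ≤ R := by
  have step : ∀ n : ℕ, ∃ p q : ℕ → G,
      (∀ j k, j ≤ n → k ≤ n → d (p j) (p k) = |(j : ℝ) - k|) ∧
      (∀ j k, j ≤ n → k ≤ n → d (q j) (q k) = |(j : ℝ) - k|) ∧
      (∀ j k, j ≤ n → k ≤ n → d (p j) (q k) = j + k) ∧
      d (p 0) 1 ≤ D ∧ p 0 = q 0 ∧
      (∀ j ≤ n, ∃ h ∈ H, d (p j) h ≤ D) ∧ (∀ j ≤ n, ∃ h ∈ H, d (q j) h ≤ D) := by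
    intro n
    obtain ⟨h, hhH, hh⟩ := hHinf.exists_notMem_finite (hd.fin (2 * n))
    simp only [Set.mem_ofPred_eq, not_le] at hh
    obtain ⟨N, γ, hγ, h0, hN⟩ := hd.geo 1 h
    have hdN : d 1 h = N := by
      rw [← h0, ← hN, hγ 0 N (Nat.zero_le _) le_rfl]; simp
    have hnN : 2 * n ≤ N := by
      rw [hdN] at hh
      exact_mod_cast hh.le
    have hqc := hD N γ hγ (by rw [h0]; exact H.one_mem) (by rw [hN]; exact hhH)
    obtain ⟨a, haH, ha⟩ := hqc n (by omega)
    have close : ∀ i ≤ N, ∃ h ∈ H, d (a⁻¹ * γ i) h ≤ D := by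
      intro i hi
      obtain ⟨b, hb, hb'⟩ := hqc i hi
      refine ⟨a⁻¹ * b, H.mul_mem (H.inv_mem haH) hb, ?_⟩
      rw [hd.inv]; exact hb'
    refine ⟨fun k => a⁻¹ * γ (n + k), fun k => a⁻¹ * γ (n - k), ?_, ?_, ?_, ?_, rfl, ?_, ?_⟩
    · intro j k hj hk
      rw [hd.inv, hγ _ _ (by omega) (by omega)]
      push_cast; congr 1; ring
    · intro j k hj hk
      rw [hd.inv, hγ _ _ (by omega) (by omega), Nat.cast_sub hj, Nat.cast_sub hk, abs_sub_comm]
      congr 1; ring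
    · intro j k hj hk
      rw [hd.inv, hγ _ _ (by omega) (by omega), Nat.cast_sub hk, abs_of_nonneg]
      · push_cast; ring
      · push_cast
        have : (0 : ℝ) ≤ j := Nat.cast_nonneg j
        have : (0 : ℝ) ≤ k := Nat.cast_nonneg k
        linarith
    · have := hd.inv a⁻¹ (γ n) a
      simp only [inv_mul_cancel] at this
      simpa [this] using ha
    · intro j hj; exact close _ (by omega)
    · intro j hj; exact close _ (by omega)
  choose p q hpp hqq hpq hp0 hpq0 hpH hqH using step
  have limp : ∀ k, ∃ c, ∀ᶠ n in (hyperfilter ℕ : Filter ℕ), p n k = c := by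
    intro k
    refine ultra_const _ _ (hd.fin (k + D)) ?_
    filter_upwards [ultra_ge k] with n hn
    have h1 := hpp n k 0 hn (Nat.zero_le _)
    have h2 := hp0 n
    have h3 := hd.tri (p n k) (p n 0) 1
    have h4 := hd.symm (p n k) 1
    simp only [Nat.cast_zero, sub_zero, Nat.abs_cast] at h1
    change d 1 _ ≤ _
    linarith
  have limq : ∀ k, ∃ c, ∀ᶠ n in (hyperfilter ℕ : Filter ℕ), q n k = c := by
    intro k
    refine ultra_const _ _ (hd.fin (k + D)) ?_
    filter_upwards [ultra_ge k] with n hn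
    have h1 := hqq n k 0 hn (Nat.zero_le _)
    have h2 := hp0 n
    rw [hpq0] at h2
    have h3 := hd.tri (q n k) (q n 0) 1
    have h4 := hd.symm (q n k) 1
    simp only [Nat.cast_zero, sub_zero, Nat.abs_cast] at h1
    change d 1 _ ≤ _
    linarith
  choose P hP using limp
  choose Q hQ using limq
  have PP : ∀ j k, d (P j) (P k) = |(j : ℝ) - k| := by
    intro j k
    obtain ⟨n, h1, h2, h3, h4⟩ := ((hP j).and ((hP k).and ((ultra_ge j).and (ultra_ge k)))).exists
    rw [← h1, ← h2]; exact hpp n j k h3 h4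
  have QQ : ∀ j k, d (Q j) (Q k) = |(j : ℝ) - k| := by
    intro j k
    obtain ⟨n, h1, h2, h3, h4⟩ := ((hQ j).and ((hQ k).and ((ultra_ge j).and (ultra_ge k)))).exists
    rw [← h1, ← h2]; exact hqq n j k h3 h4
  have PQ : ∀ j k, d (P j) (Q k) = j + k := by
    intro j k
    obtain ⟨n, h1, h2, h3, h4⟩ := ((hP j).and ((hQ k).and ((ultra_ge j).and (ultra_ge k)))).exists
    rw [← h1, ← h2]; exact hpq n j k h3 h4
  have P0 : d (P 0) 1 ≤ D := by
    obtain ⟨n, h1⟩ := (hP 0).exists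
    rw [← h1]; exact hp0 n
  have Q0 : d (Q 0) 1 ≤ D := by
    obtain ⟨n, h1⟩ := (hQ 0).exists
    rw [← h1, ← hpq0]; exact hp0 n
  have PH : ∀ k, ∃ h ∈ H, d (P k) h ≤ D := by
    intro k
    obtain ⟨n, h1, h2⟩ := ((hP k).and (ultra_ge k)).exists
    rw [← h1]; exact hpH n k h2
  have QH : ∀ k, ∃ h ∈ H, d (Q k) h ≤ D := by
    intro k
    obtain ⟨n, h1, h2⟩ := ((hQ k).and (ultra_ge k)).exists
    rw [← h1]; exact hqH n k h2
  choose u huH hu using PH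
  choose v hvH hv using QH
  have conv : ∀ (P u : ℕ → G), (∀ j k, d (P j) (P k) = |(j : ℝ) - k|) → d (P 0) 1 ≤ D →
      (∀ k, d (P k) (u k) ≤ D) → ConvergesAtInfinity d 1 u := by
    intro P u PP P0 hu
    have hlow : ∀ m n : ℕ, ((min m n : ℕ) : ℝ) - 3 * D ≤ gromovProd d (u m) (u n) 1 := by
      intro m n
      have a1 := PP 0 m
      have a2 := PP 0 n
      have a3 := PP m n
      simp only [Nat.cast_zero, zero_sub, abs_neg, Nat.abs_cast] at a1 a2
      have b1 := hd.tri (P 0) 1 (P m)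
      have b2 := hd.tri (P 0) 1 (P n)
      have b3 := hd.tri 1 (u m) (P m)
      have b4 := hd.tri 1 (u n) (P n)
      have b5 := hd.tri (u m) (P m) (u n)
      have b6 := hd.tri (P m) (P n) (u n)
      have c1 := hd.symm (u m) (P m)
      have c2 := hd.symm (u n) (P n)
      have c3 := hd.symm (u m) 1
      have c4 := hd.symm (u n) 1
      have d1 := hu m
      have d2 := hu n
      simp only [gromovProd]
      rcases le_total m n with h | h
      · rw [min_eq_left h]
        have : (m : ℝ) ≤ n := by exact_mod_cast h
        rw [abs_sub_comm, abs_of_nonneg (by linarith)] at a3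
        linarith
      · rw [min_eq_right h]
        have : (n : ℝ) ≤ m := by exact_mod_cast h
        rw [abs_of_nonneg (by linarith)] at a3
        linarith
    unfold ConvergesAtInfinity
    rw [tendsto_atTop]
    intro B
    obtain ⟨N, hN⟩ := exists_nat_ge (B + 3 * D)
    filter_upwards [eventually_ge_atTop (N, N)] with x hx
    have h1 := hlow x.1 x.2
    have h2 : N ≤ min x.1 x.2 := le_min hx.1 hx.2
    have h3 : (N : ℝ) ≤ ((min x.1 x.2 : ℕ) : ℝ) := by exact_mod_cast h2
    linarith
  refine ⟨u, v, huH, hvH, conv P u PP P0 hu, conv Q v QQ Q0 hv, 3 * D, ?_⟩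
  intro m n
  have a1 := PP m 0
  have a2 := QQ n 0
  have a3 := PQ m n
  simp only [Nat.cast_zero, sub_zero, Nat.abs_cast] at a1 a2
  have b1 := hd.tri (u m) (P m) 1
  have b2 := hd.tri (P m) (P 0) 1
  have b3 := hd.tri (v n) (Q n) 1
  have b4 := hd.tri (Q n) (Q 0) 1
  have b5 := hd.tri (P m) (u m) (Q n)
  have b6 := hd.tri (u m) (v n) (Q n)
  have c1 := hd.symm (u m) (P m)
  have c2 := hd.symm (v n) (Q n)
  have d1 := hu m
  have d2 := hv n
  simp only [gromovProd]
  linarith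

theorem conv_translate (hd : GoodDist d) (g : G) (u : ℕ → G) (hu : ConvergesAtInfinity d 1 u) :
    ConvergesAtInfinity d 1 (fun n => g * u n) := by
  unfold ConvergesAtInfinity at *
  refine tendsto_atTop_mono (f := fun p : ℕ × ℕ => gromovProd d (u p.1) (u p.2) 1 + (- d g 1)) ?_
    (tendsto_atTop_add_const_right _ _ hu)
  intro p
  simp only [gromovProd]
  have h1 := hd.tri (g * u p.1) 1 (g * 1)
  have h2 := hd.tri (g * u p.2) 1 (g * 1)
  rw [hd.inv] at h1 h2
  rw [hd.inv]
  have h3 := hd.symm 1 (g * 1)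
  rw [mul_one] at *
  linarith

/-- Finitely many cosets representatives suffice to escape from a ball after any translation. -/
theorem escape (hd : GoodDist d) (H : Subgroup G) (hHidx : H.index = 0) (M : ℝ) :
    ∃ F : Finset G, ∀ x, ∃ g ∈ F, ∀ h ∈ H, M < d 1 (x * g * h) := by
  classical
  have : Infinite (G ⧸ H) := Subgroup.index_eq_zero_iff_infinite.1 hHidx
  obtain ⟨T, hT⟩ := Infinite.exists_subset_card_eq (G ⧸ H) ((hd.fin M).toFinset.card + 1)
  refine ⟨T.image Quotient.out, ?_⟩
  intro x
  by_contra hcon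
  push Not at hcon
  have h1 : ∀ t : G ⧸ H, ∃ h, t ∈ T → h ∈ H ∧ d 1 (x * t.out * h) ≤ M := by
    intro t
    by_cases ht : t ∈ T
    · obtain ⟨h, hh, hle⟩ := hcon t.out (Finset.mem_image_of_mem _ ht)
      exact ⟨h, fun _ => ⟨hh, hle⟩⟩
    · exact ⟨1, fun h => absurd h ht⟩
  choose f hf using h1
  have hcard := Finset.card_le_card_of_injOn (s := T) (t := (hd.fin M).toFinset)
    (fun t => x * t.out * f t) (by
      intro t ht
      simpa using (hf t ht).2) (by
      intro t ht t' ht' heq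
      simp only [mul_assoc, mul_right_inj] at heq
      have e1 : ((t.out * f t : G) : G ⧸ H) = t := by
        rw [QuotientGroup.mk_mul_of_mem _ (hf t ht).1]; exact Quotient.out_eq t
      have e2 : ((t'.out * f t' : G) : G ⧸ H) = t' := by
        rw [QuotientGroup.mk_mul_of_mem _ (hf t' ht').1]; exact Quotient.out_eq t'
      rw [← e1, ← e2, heq])
  omega

variable {Z : Type*} [MetricSpace Z]

theorem visual_le (e : GromovBoundary d 1 ≃ Z) {a C : ℝ} (hvis : IsVisualMetric d 1 e a C)
    (u v : BoundarySeq d 1) (R : ℝ)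
    (h : ∀ᶠ p : ℕ × ℕ in atTop, R ≤ gromovProd d (u.seq p.1) (v.seq p.2) 1) :
    dist (e (Quot.mk _ u)) (e (Quot.mk _ v)) ≤ C * a ^ (-R) := by
  obtain ⟨ha, hC, hv⟩ := hvis
  have ha0 : 0 < a := by linarith
  by_cases hr : boundaryRel d 1 u v
  · rw [Quot.sound hr, dist_self]
    positivity
  · refine (hv u v hr).2.trans ?_
    have hcob : IsCoboundedUnder (· ≥ ·) atTop
        (fun p : ℕ × ℕ => gromovProd d (u.seq p.1) (v.seq p.2) 1) := by
      unfold boundaryRel at hr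
      rw [tendsto_atTop] at hr
      push Not at hr
      obtain ⟨b, hb⟩ := hr
      refine IsCoboundedUnder.of_frequently_le (a := b) ?_
      exact hb.mono fun p hp => le_of_lt (by simpa using hp)
    have hle : R ≤ bSeqProd d 1 u v := le_liminf_of_le hcob h
    have : a ^ (-(bSeqProd d 1 u v)) ≤ a ^ (-R) :=
      Real.rpow_le_rpow_of_exponent_le ha.le (by linarith)
    exact mul_le_mul_of_nonneg_left this (by linarith)

theorem exists_small (a C : ℝ) (ha : 1 < a) (hC : 1 ≤ C) (ε : ℝ) (hε : 0 < ε) :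
    ∃ R : ℝ, C * a ^ (-R) < ε := by
  have h1 : Tendsto (fun n : ℕ => C * (a⁻¹) ^ n) atTop (𝓝 (C * 0)) :=
    (tendsto_pow_atTop_nhds_zero_of_lt_one (by positivity) (inv_lt_one_of_one_lt₀ ha)).const_mul C
  rw [mul_zero] at h1
  obtain ⟨n, hn⟩ := (h1.eventually (gt_mem_nhds hε)).exists
  refine ⟨n, ?_⟩
  rwa [Real.rpow_neg (by linarith), Real.rpow_natCast, ← inv_pow]

/-- The piece of the pattern at `g`. -/
def piece (d : G → G → ℝ) (e : GromovBoundary d 1 ≃ Z) (H : Subgroup G) (g : G) : Set Z :=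
  e '' limitSet d 1 ((g * ·) '' (H : Set G))

theorem piece_far (hd : GoodDist d) {δ D : ℝ} (hhyp : IsGromovHyperbolicDist d δ)
    (H : Subgroup G) (hD : IsQuasiconvexWith d D (H : Set G))
    (e : GromovBoundary d 1 ≃ Z) {a C : ℝ} (hvis : IsVisualMetric d 1 e a C)
    (g : G) (R : ℝ) (hg : ∀ h ∈ H, R + 2 * δ + 1 + D < d 1 (g * h)) :
    ∀ x ∈ piece d e H g, ∀ y ∈ piece d e H g, dist x y ≤ C * a ^ (-R) := by
  rintro _ ⟨_, ⟨u, hu, rfl⟩, rfl⟩ _ ⟨_, ⟨v, hv, rfl⟩, rfl⟩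
  refine visual_le e hvis u v R (Eventually.of_forall ?_)
  intro p
  obtain ⟨h₁, hh₁, e1⟩ := hu p.1
  obtain ⟨h₂, hh₂, e2⟩ := hv p.2
  obtain ⟨h, hh, hle⟩ := coset_close hd hhyp H hD g h₁ h₂ hh₁ hh₂
  have := hg h hh
  simp only at e1 e2
  rw [← e1, ← e2]
  linarith

theorem piece_coset (e : GromovBoundary d 1 ≃ Z) (H : Subgroup G) (g h : G) (hh : h ∈ H) :
    piece d e H (g * h) = piece d e H g := by
  have : ((g * h) * ·) '' (H : Set G) = (g * ·) '' (H : Set G) := by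
    ext x
    constructor
    · rintro ⟨k, hk, rfl⟩
      exact ⟨h * k, H.mul_mem hh hk, by simp [mul_assoc]⟩
    · rintro ⟨k, hk, rfl⟩
      exact ⟨h⁻¹ * k, H.mul_mem (H.inv_mem hh) hk, by simp [mul_assoc]⟩
  rw [piece, piece, this]

/-- Only finitely many pieces of the pattern are large. -/
theorem piece_finite (hd : GoodDist d) {δ D : ℝ} (hhyp : IsGromovHyperbolicDist d δ)
    (H : Subgroup G) (hD : IsQuasiconvexWith d D (H : Set G))
    (e : GromovBoundary d 1 ≃ Z) {a C : ℝ} (hvis : IsVisualMetric d 1 e a C)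
    (r : ℝ) (hr : 0 < r) :
    {P : Set Z | P ∈ patternOf d 1 e H ∧ ∃ x ∈ P, ∃ y ∈ P, r < dist x y}.Finite := by
  obtain ⟨R, hR⟩ := exists_small a C hvis.1 hvis.2.1 r hr
  refine ((hd.fin (R + 2 * δ + 1 + D)).image (piece d e H)).subset ?_
  rintro P ⟨⟨g, rfl⟩, x, hx, y, hy, hxy⟩
  by_contra hcon
  have hfar : ∀ h ∈ H, R + 2 * δ + 1 + D < d 1 (g * h) := by
    intro h hh
    by_contra hlt
    exact hcon ⟨g * h, not_lt.1 hlt, piece_coset e H g h hh⟩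
  have := piece_far hd hhyp H hD e hvis g R hfar x hx y hy
  linarith

theorem piece_two (hd : GoodDist d) (H : Subgroup G) (hHinf : (H : Set G).Infinite)
    {D : ℝ} (hD0 : 0 ≤ D) (hD : IsQuasiconvexWith d D (H : Set G))
    (e : GromovBoundary d 1 ≃ Z) {a C : ℝ} (hvis : IsVisualMetric d 1 e a C) (g : G) :
    ∃ x ∈ piece d e H g, ∃ y ∈ piece d e H g, 0 < dist x y := by
  obtain ⟨u, v, hu, hv, cu, cv, R, hR⟩ := two_limit_points hd H hHinf hD0 hD
  refine ⟨_, ⟨_, ⟨⟨_, conv_translate hd g u cu⟩, fun n => ⟨_, hu n, rfl⟩, rfl⟩, rfl⟩,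
    _, ⟨_, ⟨⟨_, conv_translate hd g v cv⟩, fun n => ⟨_, hv n, rfl⟩, rfl⟩, rfl⟩, ?_⟩
  refine lt_of_lt_of_le ?_ (hvis.2.2 _ _ ?_).1
  · have h1 := hvis.1
    have h2 := hvis.2.1
    have : 0 < a := by linarith
    positivity
  · intro hrel
    unfold boundaryRel at hrel
    obtain ⟨p, hp⟩ := (hrel.eventually (eventually_gt_atTop (R + d g 1))).exists
    simp only [gromovProd] at hp
    rw [hd.inv] at hp
    have h0 := hR p.1 p.2
    simp only [gromovProd] at h0
    have h1 := hd.tri (g * u p.1) (g * 1) 1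
    have h2 := hd.tri (g * v p.2) (g * 1) 1
    rw [hd.inv] at h1 h2
    rw [mul_one] at *
    linarith

/-- Small pieces of the pattern accumulate everywhere. -/
theorem piece_dense (hd : GoodDist d) {δ D : ℝ} (hhyp : IsGromovHyperbolicDist d δ)
    (H : Subgroup G) (hHinf : (H : Set G).Infinite) (hHidx : H.index = 0)
    (hD0 : 0 ≤ D) (hD : IsQuasiconvexWith d D (H : Set G))
    (e : GromovBoundary d 1 ≃ Z) {a C : ℝ} (hvis : IsVisualMetric d 1 e a C)
    (z : Z) (ε : ℝ) (hε : 0 < ε) :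
    ∃ g, (piece d e H g).Nonempty ∧ ∀ x ∈ piece d e H g, dist x z < ε := by
  obtain ⟨u, v, hu, hv, cu, cv, R, hR⟩ := two_limit_points hd H hHinf hD0 hD
  obtain ⟨T, hT⟩ := exists_small a C hvis.1 hvis.2.1 (ε / 2) (by linarith)
  obtain ⟨F, hF⟩ := escape hd H hHidx (T + 2 * δ + 1 + D)
  obtain ⟨B, hB⟩ : ∃ B, ∀ g ∈ F, d g 1 ≤ B := by
    obtain ⟨B, hB⟩ := (F.image (fun g => d g 1)).bddAbove
    exact ⟨B, fun g hg => hB (by simpa using ⟨g, hg, rfl⟩)⟩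
  obtain ⟨w, rfl⟩ : ∃ w : BoundarySeq d 1, e (Quot.mk _ w) = z := by
    obtain ⟨w, hw⟩ := Quot.exists_rep (e.symm z)
    exact ⟨w, by rw [hw]; simp⟩
  have hw := w.conv
  unfold ConvergesAtInfinity at hw
  obtain ⟨⟨N₁, N₂⟩, hN⟩ := eventually_atTop.1
    (hw.eventually (eventually_ge_atTop (max (T + δ) (T + R + B + 2 * δ))))
  obtain ⟨N, hNdef⟩ : ∃ N, N = max N₁ N₂ := ⟨_, rfl⟩
  have hN' : ∀ k, N ≤ k →
      max (T + δ) (T + R + B + 2 * δ) ≤ gromovProd d (w.seq N) (w.seq k) 1 := by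
    intro k hk
    exact hN (N, k) ⟨by simp [hNdef], (by rw [hNdef]; exact le_max_right _ _ : N₂ ≤ N).trans hk⟩
  obtain ⟨x, hx⟩ : ∃ x, x = w.seq N := ⟨_, rfl⟩
  rw [← hx] at hN'
  obtain ⟨g, hgF, hg⟩ := hF x
  have hxx : T + R + B + 2 * δ ≤ d x 1 := by
    have := (le_max_right _ _).trans (hN' N le_rfl)
    rw [← hx] at this
    simp only [gromovProd, hd.self] at this
    linarith
  have hprod : ∀ m k, gromovProd d (x * g * u m) (x * g * v k) x ≤ R + B := by
    intro m k
    have h0 := hR m k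
    have h1 := hd.tri (x * g * u m) (x * g * 1) x
    have h2 := hd.tri (x * g * v k) (x * g * 1) x
    rw [hd.inv] at h1 h2
    have h3 := hd.inv x g 1
    have h4 := hB g hgF
    simp only [gromovProd] at h0 ⊢
    rw [hd.inv]
    rw [mul_one] at *
    linarith
  have near : ∀ u : ℕ → G, (∀ n, u n ∈ H) → ConvergesAtInfinity d 1 u →
      (∀ m, gromovProd d (x * g * u m) 1 x ≤ R + B + δ) →
      ∃ p ∈ piece d e H (x * g), dist p (e (Quot.mk _ w)) < ε / 2 := by
    intro u hu cu hpr
    refine ⟨_, ⟨_, ⟨⟨_, conv_translate hd (x * g) u cu⟩, fun n => ⟨_, hu n, rfl⟩, rfl⟩, rfl⟩, ?_⟩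
    refine lt_of_le_of_lt (visual_le e hvis _ _ T ?_) hT
    filter_upwards [eventually_ge_atTop (0, N)] with p hp
    have h1 := hN' p.2 hp.2
    have h2 := hpr p.1
    have h3 := hhyp (x * g * u p.1) (w.seq p.2) x 1
    have h4 : T + δ ≤ gromovProd d (x * g * u p.1) x 1 := by
      simp only [gromovProd] at h2 ⊢
      have s1 := hd.symm 1 x
      linarith
    have h5 := le_min h4 ((le_max_left _ _).trans h1)
    linarith
  have hex : ∃ p ∈ piece d e H (x * g), dist p (e (Quot.mk _ w)) < ε / 2 := by
    by_cases hc : ∀ m, gromovProd d (x * g * u m) 1 x ≤ R + B + δ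
    · exact near u hu cu hc
    · push Not at hc
      obtain ⟨m, hm⟩ := hc
      refine near v hv cv ?_
      intro k
      by_contra hk
      push Not at hk
      have h1 := hhyp (x * g * u m) (x * g * v k) 1 x
      have h2 := hprod m k
      have h3 : gromovProd d 1 (x * g * v k) x = gromovProd d (x * g * v k) 1 x := by
        simp only [gromovProd]
        rw [hd.symm 1 (x * g * v k)]; ring
      rw [h3] at h1
      have h4 := lt_min hm hk
      linarith
  obtain ⟨p, hp, hpz⟩ := hex
  refine ⟨x * g, ⟨p, hp⟩, ?_⟩
  intro y hy
  have h1 := piece_far hd hhyp H hD e hvis (x * g) T hg y hy p hp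
  have h2 := dist_triangle y p (e (Quot.mk _ w))
  linarith

end Abstract

theorem locConst {Z : Type*} [MetricSpace Z] (Q : Subgroup (Z ≃ₜ Z)) (Λ : Set (Set Z))
    (hΛ : ∀ q ∈ Q, ∀ P ∈ Λ, (⇑q) '' P ∈ Λ)
    (hfin : ∀ r : ℝ, 0 < r → {P : Set Z | P ∈ Λ ∧ ∃ x ∈ P, ∃ y ∈ P, r < dist x y}.Finite)
    (htwo : ∀ P ∈ Λ, ∃ x ∈ P, ∃ y ∈ P, 0 < dist x y) (P : Set Z) (hP : P ∈ Λ) :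
    IsLocallyConstant (fun q : Q => closure ((⇑(q : Z ≃ₜ Z)) '' P)) := by
  rw [IsLocallyConstant.iff_eventually_eq]
  intro q₀
  have hunif : ∀ ε > 0, ∀ᶠ q : Q in 𝓝 q₀, ∀ x : Z,
      dist ((q₀ : Z ≃ₜ Z) x) ((q : Z ≃ₜ Z) x) < ε := by
    have hc : Continuous (fun q : Q => UniformFun.ofFun ((q : Z ≃ₜ Z) : Z → Z)) :=
      (continuous_induced_dom (f := fun f : Z ≃ₜ Z => UniformFun.ofFun (f : Z → Z))).comp
        continuous_subtype_val
    have := UniformFun.tendsto_iff_tendstoUniformly.1 (hc.tendsto q₀)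
    exact Metric.tendstoUniformly_iff.1 this
  obtain ⟨_, ⟨x, hx, rfl⟩, _, ⟨y, hy, rfl⟩, hxy⟩ := htwo _ (hΛ q₀ q₀.2 P hP)
  obtain ⟨r, hr⟩ : ∃ r, r = dist ((q₀ : Z ≃ₜ Z) x) ((q₀ : Z ≃ₜ Z) y) := ⟨_, rfl⟩
  rw [← hr] at hxy
  have hsep : ∀ P' ∈ {P : Set Z | P ∈ Λ ∧ ∃ x ∈ P, ∃ y ∈ P, r / 2 < dist x y},
      ∀ᶠ q : Q in 𝓝 q₀, (⇑(q : Z ≃ₜ Z)) '' P = P' →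
        closure P' = closure ((⇑(q₀ : Z ≃ₜ Z)) '' P) := by
    intro P' _
    by_cases hcl : closure P' = closure ((⇑(q₀ : Z ≃ₜ Z)) '' P)
    · exact Eventually.of_forall fun _ _ => hcl
    · have hpos : 0 < Metric.hausdorffEDist P' ((⇑(q₀ : Z ≃ₜ Z)) '' P) := by
        rw [pos_iff_ne_zero]
        intro h
        exact hcl (Metric.hausdorffEDist_zero_iff_closure_eq_closure.1 h)
      obtain ⟨ε, hε0, hε⟩ := ENNReal.lt_iff_exists_nnreal_btwn.1 hpos
      have hε0' : (0 : ℝ) < ε := by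
        have : (0 : ℝ≥0) < ε := by exact_mod_cast hε0
        exact_mod_cast this
      filter_upwards [hunif ε hε0'] with q hq heq
      exfalso
      refine absurd hε (not_lt.2 ?_)
      rw [← heq]
      refine Metric.hausdorffEDist_le_of_mem_edist ?_ ?_
      · rintro _ ⟨z, hz, rfl⟩
        refine ⟨_, ⟨z, hz, rfl⟩, ?_⟩
        rw [edist_comm, edist_le_coe, ← NNReal.coe_le_coe, coe_nndist]
        exact (hq z).le
      · rintro _ ⟨z, hz, rfl⟩
        refine ⟨_, ⟨z, hz, rfl⟩, ?_⟩
        rw [edist_le_coe, ← NNReal.coe_le_coe, coe_nndist]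
        exact (hq z).le
  have hall := (Filter.eventually_all_finite (hfin (r / 2) (by linarith))).2 hsep
  filter_upwards [hall, hunif (r / 4) (by linarith)] with q hq1 hq2
  refine hq1 _ ⟨hΛ q q.2 P hP, _, ⟨x, hx, rfl⟩, _, ⟨y, hy, rfl⟩, ?_⟩ rfl
  have h1 := hq2 x
  have h2 := hq2 y
  have h3 := dist_triangle4 ((q₀ : Z ≃ₜ Z) x) ((q : Z ≃ₜ Z) x) ((q : Z ≃ₜ Z) y) ((q₀ : Z ≃ₜ Z) y)
  rw [dist_comm ((q₀ : Z ≃ₜ Z) y)] at h2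
  linarith

/-- For `G` hyperbolic and `H` an infinite quasiconvex subgroup of infinite
index, any group of pattern-preserving quasi-isometries is totally disconnected in the uniform
topology. -/
theorem pattern_preserving_qi_group_totallyDisconnected
    {G : Type} [Group G] (S : Set G) (hSfin : S.Finite) (hSgen : Subgroup.closure S = ⊤)
    (δ : ℝ) (hδ : 0 ≤ δ) (hhyp : IsGromovHyperbolicDist (wordDist G S) δ)
    (H : Subgroup G) (hHinf : (H : Set G).Infinite) (hHidx : H.index = 0)
    (hHqc : IsQuasiconvex (wordDist G S) (H : Set G))
    {Z : Type} [MetricSpace Z] (e : GromovBoundary (wordDist G S) 1 ≃ Z)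
    (a C : ℝ) (hvis : IsVisualMetric (wordDist G S) 1 e a C)
    (Q : Subgroup (Z ≃ₜ Z))
    (hQpat : ∀ q ∈ Q, PatternPreserving (wordDist G S) 1 e H (⇑q))
    (hQqi : ∀ q ∈ Q, ∃ (K ε : ℝ) (φ : G → G), 1 ≤ K ∧ 0 ≤ ε ∧
      IsQuasiIsometryDist (wordDist G S) (wordDist G S) K ε φ ∧
      BoundaryMapExtends (wordDist G S) 1 (wordDist G S) 1 e e (⇑q) φ) :
    TotallyDisconnectedSpace Q := by
  have hd := wordDist_good S hSfin hSgen
  obtain ⟨D, hD0, hD⟩ := hHqc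
  refine ⟨?_⟩
  intro t _ ht q₁ h₁ q₂ h₂
  apply Subtype.ext
  apply Homeomorph.ext
  intro z
  by_contra hne
  have hpos : 0 < dist ((q₁ : Z ≃ₜ Z) z) ((q₂ : Z ≃ₜ Z) z) := dist_pos.2 hne
  obtain ⟨η, hη⟩ : ∃ η, η = dist ((q₁ : Z ≃ₜ Z) z) ((q₂ : Z ≃ₜ Z) z) / 3 := ⟨_, rfl⟩
  have hη0 : 0 < η := by rw [hη]; linarith
  obtain ⟨ε₁, hε₁, hc₁⟩ := Metric.continuous_iff.1 (q₁ : Z ≃ₜ Z).continuous z η hη0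
  obtain ⟨ε₂, hε₂, hc₂⟩ := Metric.continuous_iff.1 (q₂ : Z ≃ₜ Z).continuous z η hη0
  obtain ⟨g, ⟨p, hp⟩, hg⟩ := piece_dense hd hhyp H hHinf hHidx hD0 hD e hvis z (min ε₁ ε₂)
    (lt_min hε₁ hε₂)
  have hloc := locConst Q (patternOf (wordDist G S) 1 e H) (fun q hq P hP => hQpat q hq P hP)
    (fun r hr => piece_finite hd hhyp H hD e hvis r hr)
    (by
      rintro P ⟨k, rfl⟩
      exact piece_two hd H hHinf hD0 hD e hvis k)
    (piece (wordDist G S) e H g) ⟨g, rfl⟩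
  have heq := hloc.apply_eq_of_isPreconnected ht h₁ h₂
  have hmem : (q₂ : Z ≃ₜ Z) p ∈ closure ((⇑(q₁ : Z ≃ₜ Z)) '' piece (wordDist G S) e H g) := by
    rw [heq]
    exact subset_closure ⟨p, hp, rfl⟩
  have hsub : closure ((⇑(q₁ : Z ≃ₜ Z)) '' piece (wordDist G S) e H g) ⊆
      Metric.closedBall ((q₁ : Z ≃ₜ Z) z) η := by
    refine closure_minimal ?_ Metric.isClosed_closedBall
    rintro _ ⟨y, hy, rfl⟩
    exact (hc₁ y ((hg y hy).trans_le (min_le_left _ _))).le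
  have h3 := Metric.mem_closedBall.1 (hsub hmem)
  have h4 := hc₂ p ((hg p hp).trans_le (min_le_right _ _))
  have h5 := dist_triangle_left ((q₁ : Z ≃ₜ Z) z) ((q₂ : Z ≃ₜ Z) z) ((q₂ : Z ≃ₜ Z) p)
  linarith
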